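/- arXiv:2502.03115 — 3 statements merged into one kernel-verified Lean document; each statement's English description precedes it below -/
import Mathlib

section
/- Let φ: ℝ² → ℝ be the Cartesian box spline φ(x) = max(1 + min(x₁, x₂, 0) − max(x₁, x₂, 0), 0). Then the Fourier transform of φ is given by φ̂(ω) = sinc(ω₁/2)·sinc(ω₂/2)·sinc((ω₁+ω₂)/2) for all ω = (ω₁, ω₂) ∈ ℝ², where sinc(t) = sin(t)/t for t ≠ 0 and sinc(0) = 1. -/
open MeasureTheory

/-- The Cartesian (CPWL) box spline `φ(x) = max(1 + min(x₁,x₂,0) − max(x₁,x₂,0), 0)`. -/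
noncomputable def boxSpline (x : ℝ × ℝ) : ℝ :=
  max (1 + min (min x.1 x.2) 0 - max (max x.1 x.2) 0) 0

/-- `sinc t = sin t / t` for `t ≠ 0`, and `sinc 0 = 1`. -/
noncomputable def sinc (t : ℝ) : ℝ := if t = 0 then 1 else Real.sin t / t

/-- Two-dimensional Fourier transform `f̂(ω) = ∫_{ℝ²} f(x) e^{−i⟨ω,x⟩} dx`. -/
noncomputable def ft2 (f : ℝ × ℝ → ℝ) (ω : ℝ × ℝ) : ℂ :=
  ∫ x : ℝ × ℝ, (f x : ℂ) * Complex.exp (-Complex.I * ((ω.1 * x.1 + ω.2 * x.2 : ℝ) : ℂ))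

/-- The character `t ↦ e^{-iat}` restricted to the centred unit interval. -/
noncomputable def unitIntervalChar (a t : ℝ) : ℂ :=
  (Set.Ioc (-1 / 2 : ℝ) (1 / 2)).indicator (fun t => Complex.exp (-Complex.I * ((a * t : ℝ) : ℂ))) t

lemma integrable_unitIntervalChar (a : ℝ) : Integrable (unitIntervalChar a) := by
  have hc : Continuous fun t : ℝ => Complex.exp (-Complex.I * ((a * t : ℝ) : ℂ)) := by fun_prop
  exact (integrable_indicator_iff measurableSet_Ioc).2
    (hc.integrableOn_Icc.mono_set Set.Ioc_subset_Icc_self)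

lemma sinc_neg (t : ℝ) : sinc (-t) = sinc t := by
  simp [sinc, neg_div_neg_eq]

lemma integral_unitIntervalChar (a : ℝ) :
    ∫ t, unitIntervalChar a t = ((sinc (a / 2) : ℝ) : ℂ) := by
  unfold unitIntervalChar
  rw [integral_indicator measurableSet_Ioc, ← intervalIntegral.integral_of_le (by norm_num)]
  by_cases ha : a = 0
  · simp [ha, sinc]
    norm_num
  have hac : (a : ℂ) ≠ 0 := by exact_mod_cast ha
  have hc : -Complex.I * (a : ℂ) ≠ 0 := mul_ne_zero (neg_ne_zero.2 Complex.I_ne_zero) hac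
  have h : ∀ t : ℝ, Complex.exp (-Complex.I * ((a * t : ℝ) : ℂ)) =
      Complex.exp (-Complex.I * (a : ℂ) * t) := fun t => by push_cast; ring_nf
  simp_rw [h]
  rw [integral_exp_mul_complex hc, sinc, if_neg (by simpa using ha)]
  push_cast
  rw [Complex.sin, div_eq_div_iff hc (by simpa using ha)]
  have h1 : -Complex.I * (a : ℂ) * (1 / 2) = -((a : ℂ) / 2) * Complex.I := by ring
  have h2 : -Complex.I * (a : ℂ) * (-1 / 2) = (a : ℂ) / 2 * Complex.I := by ring
  rw [h1, h2]
  linear_combination ((a : ℂ) / 2) * (Complex.exp (-((a : ℂ) / 2) * Complex.I) -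
    Complex.exp ((a : ℂ) / 2 * Complex.I)) * Complex.I_sq

/-- The box spline is the length of the set of `t` for which `t`, `t + x₁` and `t + x₂` all lie in
the unit interval. -/
lemma boxSpline_mul_exp_eq_integral (ω x : ℝ × ℝ) :
    (boxSpline x : ℂ) * Complex.exp (-Complex.I * ((ω.1 * x.1 + ω.2 * x.2 : ℝ) : ℂ)) =
      ∫ t, unitIntervalChar (-(ω.1 + ω.2)) t *
        (unitIntervalChar ω.1 (t + x.1) * unitIntervalChar ω.2 (t + x.2)) := by
  set E := Complex.exp (-Complex.I * ((ω.1 * x.1 + ω.2 * x.2 : ℝ) : ℂ)) with hE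
  set l := -1 / 2 - min (min x.1 x.2) 0 with hl
  set r := 1 / 2 - max (max x.1 x.2) 0 with hr
  have hmem : ∀ t, t ∈ Set.Ioc l r ↔ t ∈ Set.Ioc (-1 / 2 : ℝ) (1 / 2) ∧
      t + x.1 ∈ Set.Ioc (-1 / 2 : ℝ) (1 / 2) ∧ t + x.2 ∈ Set.Ioc (-1 / 2 : ℝ) (1 / 2) := by
    intro t
    rw [hl, hr, Set.mem_Ioc, sub_lt_comm, lt_min_iff, lt_min_iff, le_sub_comm, max_le_iff,
      max_le_iff]
    simp only [Set.mem_Ioc]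
    constructor
    · rintro ⟨⟨⟨_, _⟩, _⟩, ⟨_, _⟩, _⟩
      refine ⟨⟨?_, ?_⟩, ⟨?_, ?_⟩, ?_, ?_⟩ <;> linarith
    · rintro ⟨⟨_, _⟩, ⟨_, _⟩, _, _⟩
      refine ⟨⟨⟨?_, ?_⟩, ?_⟩, ⟨?_, ?_⟩, ?_⟩ <;> linarith
  have hfun : ∀ t, unitIntervalChar (-(ω.1 + ω.2)) t *
      (unitIntervalChar ω.1 (t + x.1) * unitIntervalChar ω.2 (t + x.2)) =
      (Set.Ioc l r).indicator (fun _ => E) t := by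
    intro t
    by_cases ht : t ∈ Set.Ioc l r
    · obtain ⟨h0, h1, h2⟩ := (hmem t).1 ht
      rw [Set.indicator_of_mem ht, unitIntervalChar, unitIntervalChar, unitIntervalChar,
        Set.indicator_of_mem h0, Set.indicator_of_mem h1, Set.indicator_of_mem h2,
        ← Complex.exp_add, ← Complex.exp_add, hE]
      congr 1
      push_cast
      ring
    · rw [Set.indicator_of_notMem ht]
      simp only [unitIntervalChar, Set.indicator_apply]
      have := (hmem t).not.1 ht
      split_ifs <;> first
        | exact absurd ⟨by assumption, by assumption, by assumption⟩ this
        | simp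
  simp_rw [hfun]
  rw [integral_indicator measurableSet_Ioc, setIntegral_const, Real.volume_real_Ioc,
    Complex.real_smul, boxSpline]
  congr 3
  rw [hl, hr]
  ring

lemma integrable_unitIntervalChar_shear (a b c : ℝ) :
    Integrable (fun p : ℝ × (ℝ × ℝ) => unitIntervalChar a p.1 *
      (unitIntervalChar b (p.1 + p.2.1) * unitIntervalChar c (p.1 + p.2.2)))
      (volume.prod volume) := by
  have hT : MeasurePreserving (fun p : ℝ × (ℝ × ℝ) => (p.1, ((p.1, p.1) : ℝ × ℝ) + p.2))
      (volume.prod volume) (volume.prod volume) :=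
    (MeasurePreserving.id volume).skew_product (g := fun t y => ((t, t) : ℝ × ℝ) + y)
      (by fun_prop) (Filter.Eventually.of_forall fun t => map_add_left_eq_self volume (t, t))
  exact hT.integrable_comp_of_integrable ((integrable_unitIntervalChar a).mul_prod
    ((integrable_unitIntervalChar b).mul_prod (integrable_unitIntervalChar c)))

/-- The Fourier transform of the Cartesian box spline is
`φ̂(ω) = sinc(ω₁/2)·sinc(ω₂/2)·sinc((ω₁+ω₂)/2)`. -/
theorem boxSpline_fourier (ω : ℝ × ℝ) :
    ft2 boxSpline ω =
      ((sinc (ω.1 / 2) * sinc (ω.2 / 2) * sinc ((ω.1 + ω.2) / 2) : ℝ) : ℂ) := by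
  unfold ft2
  simp_rw [boxSpline_mul_exp_eq_integral ω]
  rw [← integral_integral_swap (integrable_unitIntervalChar_shear (-(ω.1 + ω.2)) ω.1 ω.2)]
  have htrans : ∀ t : ℝ,
      ∫ x : ℝ × ℝ, unitIntervalChar ω.1 (t + x.1) * unitIntervalChar ω.2 (t + x.2) =
        ((sinc (ω.1 / 2) * sinc (ω.2 / 2) : ℝ) : ℂ) := by
    intro t
    have h := integral_add_left_eq_self (μ := (volume : Measure (ℝ × ℝ)))
      (fun y : ℝ × ℝ => unitIntervalChar ω.1 y.1 * unitIntervalChar ω.2 y.2) (t, t)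
    refine h.trans ?_
    rw [Measure.volume_eq_prod, integral_prod_mul, integral_unitIntervalChar,
      integral_unitIntervalChar, Complex.ofReal_mul]
  simp_rw [integral_const_mul, htrans]
  rw [integral_mul_const, integral_unitIntervalChar, neg_div, sinc_neg, ← Complex.ofReal_mul,
    mul_comm]
end

section
/- (Fourier disk, hexagonal grid) Let ω_max > 0, c ∈ ℝ, and T > 0. Then ( (T⁴/(2880π²)) ∫_{{z∈ℝ² : ‖z‖ ≤ ω_max}} c² ( (√3/2) z₁² + (√3/2) z₂² )² dz )^{1/2} = T² |c| ω_max³ / √(11520π). In particular, since 1/√(11520π) < 1/√(7680π), for c ≠ 0 the asymptotic approximation error of the Fourier-disk function on the hexagonal grid is strictly smaller than on the Cartesian grid with the same stepsize T. -/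
open MeasureTheory Real

/-- The integral of `(x² + y²)²` over the disk of radius `R`, in polar coordinates. -/
theorem setIntegral_disk_sq_add_sq_sq (R : ℝ) (hR : 0 ≤ R) :
    ∫ z in {z : ℝ × ℝ | z.1 ^ 2 + z.2 ^ 2 ≤ R ^ 2}, (z.1 ^ 2 + z.2 ^ 2) ^ 2 = π * R ^ 6 / 3 := by
  have hS : MeasurableSet {z : ℝ × ℝ | z.1 ^ 2 + z.2 ^ 2 ≤ R ^ 2} :=
    measurableSet_le (by fun_prop) (by fun_prop)
  have radial : ∀ p ∈ polarCoord.target,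
      p.1 • {z : ℝ × ℝ | z.1 ^ 2 + z.2 ^ 2 ≤ R ^ 2}.indicator
        (fun z => (z.1 ^ 2 + z.2 ^ 2) ^ 2) (polarCoord.symm p)
      = (Set.Iic R).indicator (fun r => r ^ 5) p.1 * (fun _ : ℝ => (1 : ℝ)) p.2 := by
    rintro ⟨r, θ⟩ ⟨hr, -⟩
    have hr : 0 < r := hr
    have hn : (r * cos θ) ^ 2 + (r * sin θ) ^ 2 = r ^ 2 := by
      linear_combination r ^ 2 * sin_sq_add_cos_sq θ
    simp only [polarCoord_symm_apply, Set.indicator_apply, Set.mem_ofPred_eq, Set.mem_Iic, hn,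
      pow_le_pow_iff_left₀ hr.le hR two_ne_zero, smul_eq_mul]
    split_ifs <;> ring
  rw [← integral_indicator hS, ← integral_comp_polarCoord_symm,
    setIntegral_congr_fun polarCoord.open_target.measurableSet radial, polarCoord_target,
    Measure.volume_eq_prod,
    setIntegral_prod_mul ((Set.Iic R).indicator fun r => r ^ 5) (fun _ : ℝ => (1 : ℝ)),
    setIntegral_indicator measurableSet_Iic,
    Set.Ioi_inter_Iic, ← intervalIntegral.integral_of_le hR, integral_pow]
  simp [pi_pos.le]
  ring



/-- Fourier-disk example, hexagonal grid: the asymptotic error equals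
`T²|c|ω_max³/√(11520π)`, which is strictly smaller than the Cartesian-grid value
`T²|c|ω_max³/√(7680π)` when `c ≠ 0`. -/
theorem fourier_disk_hexagonal (ωmax : ℝ) (hω : 0 < ωmax) (c : ℝ) (T : ℝ) (hT : 0 < T) :
    Real.sqrt ((T ^ 4 / (2880 * π ^ 2)) *
        ∫ z in {z : ℝ × ℝ | z.1 ^ 2 + z.2 ^ 2 ≤ ωmax ^ 2},
          c ^ 2 * ((Real.sqrt 3 / 2) * z.1 ^ 2 + (Real.sqrt 3 / 2) * z.2 ^ 2) ^ 2)
      = T ^ 2 * |c| * ωmax ^ 3 / Real.sqrt (11520 * π) ∧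
    (c ≠ 0 →
      T ^ 2 * |c| * ωmax ^ 3 / Real.sqrt (11520 * π)
        < T ^ 2 * |c| * ωmax ^ 3 / Real.sqrt (7680 * π)) := by
  have hint : ∫ z in {z : ℝ × ℝ | z.1 ^ 2 + z.2 ^ 2 ≤ ωmax ^ 2},
      c ^ 2 * ((Real.sqrt 3 / 2) * z.1 ^ 2 + (Real.sqrt 3 / 2) * z.2 ^ 2) ^ 2
      = c ^ 2 * (3 / 4) * (π * ωmax ^ 6 / 3) := by
    rw [← setIntegral_disk_sq_add_sq_sq ωmax hω.le, ← integral_const_mul]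
    congr 1 with z
    have h3 : Real.sqrt 3 ^ 2 = 3 := Real.sq_sqrt (by norm_num)
    linear_combination c ^ 2 / 4 * (z.1 ^ 2 + z.2 ^ 2) ^ 2 * h3
  have hπ := pi_pos
  refine ⟨?_, fun hc => ?_⟩
  · rw [hint, Real.sqrt_eq_iff_mul_self_eq (by positivity) (by positivity), div_mul_div_comm,
      Real.mul_self_sqrt (by positivity)]
    field_simp
    rw [sq_abs]
    ring
  · have hc' : 0 < |c| := abs_pos.mpr hc
    exact div_lt_div_of_pos_left (by positivity) (by positivity)
      (Real.sqrt_lt_sqrt (by positivity) (by linarith))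
end

section
/- (Theorem 3) Let ReLU(t) = max(t, 0). For all x = (x₁, x₂) ∈ ℝ², the Cartesian box spline satisfies max(1 + min(x₁, x₂, 0) − max(x₁, x₂, 0), 0) = ReLU(1 − ReLU(x₁ − x₂) − ReLU(x₂) − ReLU(−x₁)). -/
/-- `ReLU(t) = max(t, 0)`. -/
noncomputable def ReLU (t : ℝ) : ℝ := max t 0

/-- Theorem 3: the Cartesian box spline as a two-layer ReLU network:
`φ(x) = ReLU(1 − ReLU(x₁ − x₂) − ReLU(x₂) − ReLU(−x₁))`. -/
theorem boxSpline_as_relu (x₁ x₂ : ℝ) :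
    max (1 + min (min x₁ x₂) 0 - max (max x₁ x₂) 0) 0
      = ReLU (1 - ReLU (x₁ - x₂) - ReLU x₂ - ReLU (-x₁)) := by
  unfold ReLU
  congr 1
  rcases le_total x₁ x₂ with h | h <;> rcases le_total x₁ 0 with h₁ | h₁ <;>
    rcases le_total x₂ 0 with h₂ | h₂ <;> grind
end
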